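/- Let n ≥ 2 and 1 ≤ r, s < ∞ with 1/r + 1/s > 1. If (1/r, 1/s) does not belong to the closed triangle L_n, then the sparse bound ‖M_lac : (r,s)_m‖ < ∞ fails; that is, for every constant C there exist bounded compactly supported measurable f, g ≥ 0 such that ∫ (M_lac f)·g dx > C · sup Λ_{𝒮,r,s,m}(f,g), the supremum over all sparse collections 𝒮 and all admissible families {F_S}. -/

import Mathlib

open MeasureTheory Metric Set
open scoped ENNReal NNReal

noncomputable section

abbrev Rn (n : ℕ) := EuclideanSpace ℝ (Fin n)

/-- The normalized rotation-invariant measure on the unit sphere of `ℝⁿ`. -/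
def sphMeasure (n : ℕ) : Measure (Rn n) :=
  ((μH[(n : ℝ) - 1]) (sphere (0 : Rn n) 1))⁻¹ • (μH[(n : ℝ) - 1]).restrict (sphere (0 : Rn n) 1)

/-- The spherical average `A_t f (x)`. -/
def sphereAvg (n : ℕ) (t : ℝ) (f : Rn n → ℝ) (x : Rn n) : ℝ :=
  ∫ y, f (x - t • y) ∂(sphMeasure n)

/-- The lacunary spherical maximal function. -/
def Mlac (n : ℕ) (f : Rn n → ℝ) (x : Rn n) : ℝ :=
  ⨆ j : ℤ, sphereAvg n ((2 : ℝ) ^ j) (fun z => |f z|) x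

/-- The full spherical maximal function. -/
def Mfull (n : ℕ) (f : Rn n → ℝ) (x : Rn n) : ℝ :=
  ⨆ t : {t : ℝ // 0 < t}, sphereAvg n (t : ℝ) (fun z => |f z|) x

/-- An axis-parallel cube in `ℝⁿ`. -/
structure Cube (n : ℕ) where
  corner : Fin n → ℝ
  side : ℝ
  side_pos : 0 < side

/-- The set of points of a cube. -/
def Cube.toSet {n : ℕ} (Q : Cube n) : Set (Rn n) :=
  {x | ∀ i, Q.corner i ≤ x i ∧ x i ≤ Q.corner i + Q.side}

/-- `⟨f⟩_{Q,r}`, the normalized `L^r` average of `f` over the cube `Q`. -/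
def cubeAvg {n : ℕ} (Q : Cube n) (r : ℝ) (f : Rn n → ℝ) : ℝ :=
  ((volume Q.toSet).toReal⁻¹ * ∫ x in Q.toSet, |f x| ^ r) ^ (1 / r)

/-- The plain average of `w` over a cube `Q`. -/
def avgCube {n : ℕ} (Q : Cube n) (w : Rn n → ℝ) : ℝ :=
  (volume Q.toSet).toReal⁻¹ * ∫ x in Q.toSet, w x

/-- A sparse collection of cubes. -/
def IsSparse {n : ℕ} (𝒮 : Set (Cube n)) : Prop :=
  ∃ E : Cube n → Set (Rn n),
    (∀ S ∈ 𝒮, MeasurableSet (E S)) ∧ (∀ S ∈ 𝒮, E S ⊆ S.toSet) ∧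
    (∀ S ∈ 𝒮, volume S.toSet < 4 * volume (E S)) ∧
    𝒮.PairwiseDisjoint E

/-- An admissible family `{F_S}` for the `m`-sparse form: pairwise disjoint, `F_S ⊆ S`. -/
def IsAdmissible {n : ℕ} (𝒮 : Set (Cube n)) (F : Cube n → Set (Rn n)) : Prop :=
  (∀ S ∈ 𝒮, MeasurableSet (F S)) ∧ (∀ S ∈ 𝒮, F S ⊆ S.toSet) ∧ 𝒮.PairwiseDisjoint F

/-- The `(r,s)_m`-sparse form `Λ_{𝒮,r,s,m}(f,g)`. -/
def sparseFormM {n : ℕ} (𝒮 : Set (Cube n)) (F : Cube n → Set (Rn n)) (r s : ℝ)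
    (f g : Rn n → ℝ) : ℝ≥0∞ :=
  ∑' S : 𝒮, volume (S : Cube n).toSet * ENNReal.ofReal (cubeAvg (S : Cube n) r f) *
    ENNReal.ofReal (cubeAvg (S : Cube n) s ((F (S : Cube n)).indicator g))

/-- The supremum of `(r,s)_m` sparse forms over all sparse collections and admissible families. -/
def supSparseFormM (n : ℕ) (r s : ℝ) (f g : Rn n → ℝ) : ℝ≥0∞ :=
  ⨆ (𝒮 : Set (Cube n)) (F : Cube n → Set (Rn n)) (_ : IsSparse 𝒮) (_ : IsAdmissible 𝒮 F),
    sparseFormM 𝒮 F r s f g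

/-- The sparse bound `‖T : (r,s)_m‖ < ∞`. -/
def SparseBoundM (n : ℕ) (r s : ℝ) (T : (Rn n → ℝ) → Rn n → ℝ) : Prop :=
  ∃ C : ℝ, 0 ≤ C ∧ ∀ f g : Rn n → ℝ, Measurable f → Measurable g →
    (∀ x, 0 ≤ f x) → (∀ x, 0 ≤ g x) →
    (∃ M, ∀ x, f x ≤ M) → (∃ M, ∀ x, g x ≤ M) →
    HasCompactSupport f → HasCompactSupport g →
    ENNReal.ofReal (∫ x, T f x * g x) ≤ ENNReal.ofReal C * supSparseFormM n r s f g

/-- The closed triangle `L_n` with vertices `(0,1)`, `(1,0)`, `(n/(n+1), n/(n+1))`. -/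
def Lregion (n : ℕ) : Set (ℝ × ℝ) :=
  convexHull ℝ {((0 : ℝ), (1 : ℝ)), (1, 0), ((n : ℝ)/(n+1), (n : ℝ)/(n+1))}

/-- The closed triangle `L'_n` with vertices `(0,0)`, `(1,1)`, `(n/(n+1), 1/(n+1))`. -/
def Lregion' (n : ℕ) : Set (ℝ × ℝ) :=
  convexHull ℝ {((0 : ℝ), (0 : ℝ)), (1, 1), ((n : ℝ)/(n+1), 1/((n : ℝ)+1))}

/-- The closed trapezium `F_n`. -/
def Fregion (n : ℕ) : Set (ℝ × ℝ) :=
  convexHull ℝ {((0 : ℝ), (1 : ℝ)), (((n : ℝ)-1)/n, 1/(n : ℝ)),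
    (((n : ℝ)-1)/n, ((n : ℝ)-1)/n),
    (((n : ℝ)^2 - n)/((n : ℝ)^2 + 1), ((n : ℝ)^2 - n + 2)/((n : ℝ)^2 + 1))}

/-- The closed trapezium `F'_n`. -/
def Fregion' (n : ℕ) : Set (ℝ × ℝ) :=
  convexHull ℝ {((0 : ℝ), (0 : ℝ)), (((n : ℝ)-1)/n, ((n : ℝ)-1)/n),
    (((n : ℝ)-1)/n, 1/(n : ℝ)),
    (((n : ℝ)^2 - n)/((n : ℝ)^2 + 1), ((n : ℝ)-1)/((n : ℝ)^2 + 1))}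

/-- A dyadic cube `2^q([0,1)^n + m)`. -/
def IsDyadic {n : ℕ} (Q : Cube n) : Prop :=
  ∃ (q : ℤ) (m : Fin n → ℤ), Q.side = (2 : ℝ) ^ q ∧ ∀ i, Q.corner i = (2 : ℝ) ^ q * m i

/-- The concentric cube `(1/3)Q` of one third the side length. -/
def Cube.third {n : ℕ} (Q : Cube n) : Cube n :=
  ⟨fun i => Q.corner i + Q.side / 3, Q.side / 3, by have := Q.side_pos; linarith⟩

/-- `A_Q f = A_{ℓQ/4}(f · 1_{(1/3)Q})`. -/
def AQ {n : ℕ} (Q : Cube n) (f : Rn n → ℝ) (x : Rn n) : ℝ :=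
  sphereAvg n (Q.side / 4) (Q.third.toSet.indicator f) x

/-- `M̃_Q f = sup_{ℓQ/8 ≤ t < ℓQ/4} A_t (f · 1_{(1/3)Q})`. -/
def MtildeQ {n : ℕ} (Q : Cube n) (f : Rn n → ℝ) (x : Rn n) : ℝ :=
  ⨆ t : {t : ℝ // Q.side / 8 ≤ t ∧ t < Q.side / 4},
    sphereAvg n (t : ℝ) (Q.third.toSet.indicator f) x

/-- A weight: a positive locally integrable function. -/
def IsWeight {n : ℕ} (w : Rn n → ℝ) : Prop :=
  (∀ x, 0 < w x) ∧ LocallyIntegrable w volume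

/-- The Muckenhoupt class `A₁`. -/
def MemA1 {n : ℕ} (w : Rn n → ℝ) : Prop :=
  IsWeight w ∧ ∃ C : ℝ, ∀ Q : Cube n, ∀ᵐ x ∂volume, x ∈ Q.toSet → avgCube Q w ≤ C * w x

/-- The Muckenhoupt class `A_p`, `1 < p < ∞`. -/
def MemAp {n : ℕ} (p : ℝ) (w : Rn n → ℝ) : Prop :=
  IsWeight w ∧ ∃ C : ℝ, ∀ Q : Cube n,
    avgCube Q w * (avgCube Q fun x => w x ^ (1 - p/(p-1))) ^ (p - 1) ≤ C

/-- The reverse Hölder class `RH_ρ`. -/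
def MemRH {n : ℕ} (ρ : ℝ) (w : Rn n → ℝ) : Prop :=
  IsWeight w ∧ ∃ C : ℝ, ∀ Q : Cube n, cubeAvg Q ρ w ≤ C * avgCube Q w

/-- The measure `w dx` associated to a weight. -/
def wMeasure {n : ℕ} (w : Rn n → ℝ) : Measure (Rn n) :=
  volume.withDensity fun x => ENNReal.ofReal (w x)

/-- The dual exponent `x' = x/(x-1)`. -/
def dualExp (x : ℝ) : ℝ := x / (x - 1)

/-- `φ_lac(r)`, defined through `1/φ_lac(1/r)` as in Corollary 5.4(1). -/
def phiLac (n : ℕ) (r : ℝ) : ℝ :=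
  if 1/r ≤ (n : ℝ)/(n+1) then (1 - 1/(r*n))⁻¹ else ((n : ℝ)*(1 - 1/r))⁻¹

/-- `φ_full(r)`, the piecewise linear function of Statement 16. -/
def phiFull (n : ℕ) (r : ℝ) : ℝ :=
  if 1/r ≤ ((n : ℝ)^2 - n)/((n : ℝ)^2 + 1) then (1 - 1/(r*n))⁻¹
  else (((n : ℝ)-1)/n + (((n : ℝ)+1)/((n : ℝ)-1)) * ((((n : ℝ)-1))/n - 1/r))⁻¹

end

open MeasureTheory Metric Set
open scoped ENNReal NNReal

section Aux
open Filter Topology Module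

theorem sph_finite (n : ℕ) (hn : 2 ≤ n) :
    (μH[(n : ℝ) - 1]) (sphere (0 : Rn n) 1) < ∞ := by
  have hd : (0:ℝ) ≤ (n:ℝ) - 1 := by
    have : (2:ℝ) ≤ n := by exact_mod_cast hn
    linarith
  refine (isCompact_sphere (0 : Rn n) 1).measure_lt_top_of_nhdsWithin ?_
  intro v hv
  have hv1 : ‖v‖ = 1 := by simpa using hv
  have hv0 : v ≠ 0 := by intro h; simp [h] at hv1
  have : Fact (finrank ℝ (Rn n) = (n - 1) + 1) := ⟨by rw [finrank_euclideanSpace_fin]; omega⟩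
  let E := (ℝ ∙ v)ᗮ
  have hfr : (finrank ℝ E : ℝ) = (n:ℝ) - 1 := by
    rw [Submodule.finrank_orthogonal_span_singleton (n := n-1) hv0]
    rw [Nat.cast_sub (by omega)]; simp
  have hH : (μH[(n:ℝ) - 1] : Measure E).IsAddHaarMeasure := by
    rw [← hfr]; infer_instance
  let φ : E → Rn n := fun z => (z : Rn n) + Real.sqrt (1 - ‖z‖^2) • v
  have hφ : ContDiffAt ℝ 1 φ 0 := by
    apply ContDiffAt.add
    · exact E.subtypeL.contDiff.contDiffAt
    · refine ContDiffAt.smul (f := fun z : E => Real.sqrt (1 - ‖z‖^2)) (g := fun _ => v) ?_ contDiffAt_const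
      apply ContDiffAt.sqrt
      · exact contDiffAt_const.sub (contDiff_norm_sq ℝ).contDiffAt
      · simp
  obtain ⟨K, t, ht, hK⟩ := hφ.exists_lipschitzOnWith
  obtain ⟨u, hu, hu'⟩ := (μH[(n:ℝ) - 1] : Measure E).finiteAt_nhds 0
  let P := E.orthogonalProjectionOnto
  have hP0 : P v = 0 := by
    apply Submodule.orthogonalProjectionOnto_apply_of_mem_orthogonal
    exact Submodule.le_orthogonal_orthogonal _ (Submodule.mem_span_singleton_self v)
  refine ⟨φ '' (t ∩ u), ?_, ?_⟩
  · have h1 : ∀ᶠ y in 𝓝 v, P y ∈ t ∩ u := by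
      apply P.continuous.continuousAt
      rw [hP0]; exact inter_mem ht hu
    have h2 : ∀ᶠ y in 𝓝 v, 0 < inner ℝ v y := by
      have : Continuous fun y : Rn n => (inner ℝ v y : ℝ) := by fun_prop
      apply this.continuousAt.eventually
      apply lt_mem_nhds
      simp [hv1]
    filter_upwards [mem_nhdsWithin_of_mem_nhds h1, mem_nhdsWithin_of_mem_nhds h2, self_mem_nhdsWithin] with y h1 h2 h3
    refine ⟨P y, h1, ?_⟩
    have h3 : ‖y‖ = 1 := by simpa using h3
    have hdec : y = (P y : Rn n) + (inner ℝ v y : ℝ) • v := by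
      have h := Submodule.starProjection_add_starProjection_orthogonal (K := ℝ ∙ v) y
      rw [Submodule.starProjection_unit_singleton ℝ hv1] at h
      rw [add_comm]; exact h.symm
    have horth : inner ℝ (P y : Rn n) v = (0:ℝ) := by
      exact Submodule.mem_orthogonal_singleton_iff_inner_left.1 (P y).2
    have hn2 : 1 = ‖(P y)‖^2 + (inner ℝ v y : ℝ)^2 := by
      have := norm_add_sq_real (P y : Rn n) ((inner ℝ v y : ℝ) • v)
      rw [← hdec, h3, inner_smul_right, horth, norm_smul, hv1] at this
      simpa using this
    change (P y : Rn n) + Real.sqrt (1 - ‖P y‖^2) • v = y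
    rw [show 1 - ‖P y‖^2 = (inner ℝ v y : ℝ)^2 by linarith, Real.sqrt_sq h2.le]
    exact hdec.symm
  · refine (hK.mono inter_subset_left).hausdorffMeasure_image_le hd |>.trans_lt ?_
    apply ENNReal.mul_lt_top
    · exact ENNReal.rpow_lt_top_of_nonneg hd (by simp)
    · exact (measure_mono inter_subset_right).trans_lt hu'

theorem sph_pos (n : ℕ) (hn : 2 ≤ n) :
    (μH[(n : ℝ) - 1]) (sphere (0 : Rn n) 1) ≠ 0 := by
  have hd : (0:ℝ) ≤ (n:ℝ) - 1 := by
    have : (2:ℝ) ≤ n := by exact_mod_cast hn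
    linarith
  have : Nontrivial (Rn n) := by
    have : Nonempty (Fin n) := ⟨⟨0, by omega⟩⟩
    infer_instance
  obtain ⟨v, hv1⟩ := exists_norm_eq (Rn n) (zero_le_one' ℝ)
  have hv0 : v ≠ 0 := by intro h; simp [h] at hv1
  have : Fact (finrank ℝ (Rn n) = (n - 1) + 1) := ⟨by rw [finrank_euclideanSpace_fin]; omega⟩
  let E := (ℝ ∙ v)ᗮ
  have hfr : (finrank ℝ E : ℝ) = (n:ℝ) - 1 := by
    rw [Submodule.finrank_orthogonal_span_singleton (n := n-1) hv0]
    rw [Nat.cast_sub (by omega)]; simp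
  have hH : (μH[(n:ℝ) - 1] : Measure E).IsAddHaarMeasure := by
    rw [← hfr]; infer_instance
  let P := E.orthogonalProjectionOnto
  have hP0 : P v = 0 := by
    apply Submodule.orthogonalProjectionOnto_apply_of_mem_orthogonal
    exact Submodule.le_orthogonal_orthogonal _ (Submodule.mem_span_singleton_self v)
  have hsub : ball (0 : E) 1 ⊆ P '' sphere (0 : Rn n) 1 := by
    intro z hz
    have hz : ‖z‖ < 1 := by simpa using hz
    refine ⟨(z : Rn n) + Real.sqrt (1 - ‖z‖^2) • v, ?_, ?_⟩
    · have horth : inner ℝ (z : Rn n) v = (0:ℝ) := 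
        Submodule.mem_orthogonal_singleton_iff_inner_left.1 z.2
      have := norm_add_sq_real (z : Rn n) (Real.sqrt (1 - ‖z‖^2) • v)
      rw [inner_smul_right, horth, norm_smul, hv1, mul_one, Real.norm_eq_abs, sq_abs, Real.sq_sqrt (by nlinarith [norm_nonneg z])] at this
      simp only [mem_sphere_iff_norm, sub_zero]
      have h : ‖(z : Rn n) + Real.sqrt (1 - ‖z‖^2) • v‖^2 = 1 := by
        rw [this]; simp
      exact (pow_eq_one_iff_of_nonneg (norm_nonneg _) two_ne_zero).1 h
    · rw [map_add, map_smul, hP0]; simp [P]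
  intro h0
  have hL : LipschitzWith 1 P := by
    have := P.lipschitz
    apply this.weaken
    exact_mod_cast Submodule.orthogonalProjectionOnto_norm_le E
  have := (measure_mono hsub).trans (hL.hausdorffMeasure_image_le hd _)
  rw [h0, mul_zero] at this
  exact (measure_ball_pos (μH[(n:ℝ) - 1] : Measure E) 0 one_pos).not_ge this

theorem sphMeasure_prob (n : ℕ) (hn : 2 ≤ n) : IsProbabilityMeasure (sphMeasure n) := by
  constructor
  simp only [sphMeasure, Measure.smul_apply, Measure.restrict_apply_univ, smul_eq_mul]
  exact ENNReal.inv_mul_cancel (sph_pos n hn) (sph_finite n hn).ne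

theorem sphMeasure_ae (n : ℕ) : ∀ᵐ y ∂(sphMeasure n), ‖y‖ = 1 := by
  unfold sphMeasure
  apply Measure.ae_smul_measure
  filter_upwards [ae_restrict_mem isClosed_sphere.measurableSet] with y hy
  simpa using hy

theorem cube_vol {n : ℕ} (Q : Cube n) : volume Q.toSet = ENNReal.ofReal (Q.side ^ n) := by
  have h : Q.toSet = (WithLp.ofLp : Rn n → (Fin n → ℝ)) ⁻¹' (Icc Q.corner (fun i => Q.corner i + Q.side)) := by
    ext x
    simp only [Cube.toSet, mem_ofPred_eq, mem_preimage, mem_Icc, Pi.le_def]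
    exact forall_and
  rw [h, (PiLp.volume_preserving_ofLp (Fin n)).measure_preimage measurableSet_Icc.nullMeasurableSet,
    Real.volume_Icc_pi]
  simp [ENNReal.ofReal_pow Q.side_pos.le]

theorem cube_dist {n : ℕ} (Q : Cube n) {x y : Rn n} (hx : x ∈ Q.toSet) (hy : y ∈ Q.toSet) :
    dist x y ≤ n * Q.side := by
  rw [EuclideanSpace.dist_eq]
  apply Real.sqrt_le_iff.2
  have hl := Q.side_pos
  refine ⟨by positivity, ?_⟩
  calc ∑ i, dist (x i) (y i) ^ 2 ≤ ∑ i : Fin n, Q.side ^ 2 := by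
        apply Finset.sum_le_sum
        intro i _
        apply pow_le_pow_left₀ dist_nonneg
        rw [Real.dist_eq, abs_le]
        constructor <;> linarith [hx i, hy i]
    _ = n * Q.side ^ 2 := by simp
    _ ≤ (n * Q.side) ^ 2 := by
        rw [mul_pow]
        gcongr
        rcases Nat.eq_zero_or_pos n with h | h
        · simp [h]
        · have : (1:ℝ) ≤ n := by exact_mod_cast h
          nlinarith

theorem cubeAvg_le {n : ℕ} (Q : Cube n) {r : ℝ} (hr : 1 ≤ r) {U : Set (Rn n)} (hU : MeasurableSet U)
    (hU' : volume U ≠ ∞) {h : Rn n → ℝ} (h0 : ∀ x, 0 ≤ h x) (h1 : ∀ x, h x ≤ U.indicator 1 x) :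
    cubeAvg Q r h ≤ (volume.real U / Q.side ^ n) ^ (1 / r) := by
  have hl := Q.side_pos
  have hle : ∀ x, |h x| ^ r ≤ U.indicator (1 : Rn n → ℝ) x := by
    intro x
    have a := h0 x
    have b := h1 x
    rw [abs_of_nonneg a]
    by_cases hx : x ∈ U
    · rw [indicator_of_mem hx] at *
      exact Real.rpow_le_one a b (by linarith)
    · rw [indicator_of_notMem hx] at *
      rw [le_antisymm b a, Real.zero_rpow (by linarith)]
  have hint : Integrable (U.indicator (1 : Rn n → ℝ)) := 
    (integrable_indicator_iff hU).2 (integrableOn_const hU')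
  unfold cubeAvg
  apply Real.rpow_le_rpow
  · apply mul_nonneg (by positivity)
    apply integral_nonneg
    intro x; positivity
  · rw [cube_vol, ENNReal.toReal_ofReal (by positivity), div_eq_inv_mul]
    gcongr
    calc ∫ x in Q.toSet, |h x| ^ r ≤ ∫ x in Q.toSet, U.indicator (1 : Rn n → ℝ) x := by
          apply integral_mono_of_nonneg
          · exact Eventually.of_forall fun x => by positivity
          · exact hint.integrableOn
          · exact Eventually.of_forall hle
      _ ≤ ∫ x, U.indicator (1 : Rn n → ℝ) x := by
          apply setIntegral_le_integral hint
          exact Eventually.of_forall fun x => indicator_nonneg (fun _ _ => zero_le_one) x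
      _ = volume.real U := by
          rw [integral_indicator_one hU]
  · positivity

theorem cubeAvg_zero {n : ℕ} (Q : Cube n) {r : ℝ} (hr : 1 ≤ r) {h : Rn n → ℝ}
    (h1 : ∀ x ∈ Q.toSet, h x = 0) : cubeAvg Q r h = 0 := by
  unfold cubeAvg
  have hm : MeasurableSet Q.toSet := by
    have : IsClosed Q.toSet := by
      simp only [Cube.toSet, ofPred_forall, ofPred_and]
      refine isClosed_iInter fun i => IsClosed.inter ?_ ?_
      · exact isClosed_le (by fun_prop) (by fun_prop)
      · exact isClosed_le (by fun_prop) (by fun_prop)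
    exact this.measurableSet
  rw [setIntegral_eq_zero_of_forall_eq_zero (fun x hx => by rw [h1 x hx, abs_zero, Real.zero_rpow (by linarith)]),
    mul_zero, Real.zero_rpow]
  have : 0 < r := by linarith
  positivity

theorem sparse_le (n : ℕ) (hn : 2 ≤ n) (r s : ℝ) (hr : 1 ≤ r) (hs : 1 ≤ s)
    (hrs : 1 < 1/r + 1/s) : ∃ K : ℝ, 0 ≤ K ∧ ∀ U V : Set (Rn n), MeasurableSet U → MeasurableSet V →
      U ⊆ closedBall 0 2 → V ⊆ closedBall 0 2 → (∀ u ∈ U, ∀ v ∈ V, 1/2 ≤ dist u v) →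
      supSparseFormM n r s (U.indicator 1) (V.indicator 1) ≤
        ENNReal.ofReal (K * (volume.real U ^ (1/r) * volume.real V ^ (1/s))) := by
  have hn' : (2:ℝ) ≤ n := by exact_mod_cast hn
  set p : ℝ := n * (1/r + 1/s) with hp
  have hfin : (∫⁻ x : Rn n, ENNReal.ofReal ((1 + ‖x‖) ^ (-p))) < ∞ := by
    apply finite_integral_one_add_norm
    rw [finrank_euclideanSpace_fin, hp]
    nlinarith
  set I := (∫⁻ x : Rn n, ENNReal.ofReal ((1 + ‖x‖) ^ (-p))) with hI
  set c : ℝ := 7 * n with hc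
  refine ⟨4 * c ^ p * I.toReal, by positivity, ?_⟩
  intro U V hU hV hU2 hV2 hUV
  have hUf : volume U ≠ ∞ := ((measure_mono hU2).trans_lt measure_closedBall_lt_top).ne
  have hVf : volume V ≠ ∞ := ((measure_mono hV2).trans_lt measure_closedBall_lt_top).ne
  set W := volume.real U ^ (1/r) * volume.real V ^ (1/s) with hW
  have hW0 : 0 ≤ W := by positivity
  clear_value W
  unfold supSparseFormM
  refine iSup_le fun 𝒮 => iSup_le fun F => iSup_le fun hsp => iSup_le fun hF => ?_
  obtain ⟨E, hEm, hES, hEv, hEd⟩ := hsp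
  set w : Rn n → ℝ≥0∞ := fun x => ENNReal.ofReal ((1 + ‖x‖) ^ (-p)) with hw
  have key : ∀ S : 𝒮, volume (S : Cube n).toSet * ENNReal.ofReal (cubeAvg (S : Cube n) r (U.indicator 1)) *
      ENNReal.ofReal (cubeAvg (S : Cube n) s ((F (S : Cube n)).indicator (V.indicator 1))) ≤
      ENNReal.ofReal (4 * c ^ p * W) * (volume.withDensity w) (E S) := by
    rintro ⟨S, hS⟩
    simp only
    by_cases hSU : ∃ x ∈ S.toSet, x ∈ U
    swap
    · rw [cubeAvg_zero S hr (h := U.indicator 1)]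
      · simp
      · intro x hx
        exact indicator_of_notMem (fun h => hSU ⟨x, hx, h⟩) _
    by_cases hSV : ∃ x ∈ S.toSet, x ∈ V
    swap
    · rw [cubeAvg_zero S hs (h := (F S).indicator (V.indicator 1))]
      · simp
      · intro x hx
        exact indicator_apply_eq_zero.2 fun _ => indicator_of_notMem (fun h => hSV ⟨x, hx, h⟩) _
    obtain ⟨u, huS, huU⟩ := hSU
    obtain ⟨v, hvS, hvV⟩ := hSV
    have hl := S.side_pos
    have h1 := (hUV u huU v hvV).trans (cube_dist S huS hvS)
    have hb : ∀ x ∈ S.toSet, 1 + ‖x‖ ≤ c * S.side := by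
      intro x hx
      have h2 := cube_dist S hx huS
      have h3 : ‖u‖ ≤ 2 := by simpa using hU2 huU
      have h4 : ‖x‖ ≤ ‖x - u‖ + ‖u‖ := by simpa using norm_add_le (x - u) u
      rw [dist_eq_norm] at h2
      rw [hc]; nlinarith
    have hc0 : 0 < c := by rw [hc]; positivity
    have hp0 : 0 ≤ p := by positivity
    have hb2 : ∀ x ∈ S.toSet, S.side ^ (-p) ≤ c ^ p * (1 + ‖x‖) ^ (-p) := by
      intro x hx
      have : (c * S.side) ^ (-p) ≤ (1 + ‖x‖) ^ (-p) :=
        Real.rpow_le_rpow_of_nonpos (by positivity) (hb x hx) (by linarith)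
      calc S.side ^ (-p) = c ^ p * (c * S.side) ^ (-p) := by
            rw [Real.mul_rpow hc0.le hl.le, ← mul_assoc, ← Real.rpow_add hc0]; simp
        _ ≤ _ := by gcongr
    have hA := cubeAvg_le S hr hU hUf (h := U.indicator 1) (fun x => indicator_nonneg (fun _ _ => zero_le_one) x) (fun x => le_rfl)
    have hB := cubeAvg_le S hs hV hVf (h := (F S).indicator (V.indicator 1))
      (fun x => indicator_nonneg (fun _ _ => indicator_nonneg (fun _ _ => zero_le_one) _) x)
      (fun x => indicator_le_self' (fun _ _ => indicator_nonneg (fun _ _ => zero_le_one) _) x)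
    have hprod : (volume.real U / S.side ^ n) ^ (1 / r) * (volume.real V / S.side ^ n) ^ (1 / s) = W * S.side ^ (-p) := by
      rw [Real.div_rpow (by positivity) (by positivity), Real.div_rpow (by positivity) (by positivity),
        ← Real.rpow_natCast, ← Real.rpow_mul hl.le, ← Real.rpow_mul hl.le, div_mul_div_comm, ← Real.rpow_add hl,
        ← mul_add, ← hp, ← hW, Real.rpow_neg hl.le, div_eq_mul_inv]
    calc volume S.toSet * ENNReal.ofReal (cubeAvg S r (U.indicator 1)) *
          ENNReal.ofReal (cubeAvg S s ((F S).indicator (V.indicator 1)))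
        ≤ (4 * volume (E S)) * ENNReal.ofReal ((volume.real U / S.side ^ n) ^ (1 / r)) *
          ENNReal.ofReal ((volume.real V / S.side ^ n) ^ (1 / s)) := by
          gcongr
          exact (hEv S hS).le
      _ = ENNReal.ofReal (4 * W) * (ENNReal.ofReal (S.side ^ (-p)) * volume (E S)) := by
          rw [mul_assoc, ← ENNReal.ofReal_mul (by positivity), hprod, ENNReal.ofReal_mul hW0,
            ENNReal.ofReal_mul (p := 4) (by norm_num)]
          rw [show ENNReal.ofReal 4 = 4 by simp]
          ring
      _ = ENNReal.ofReal (4 * W) * (∫⁻ x in E S, ENNReal.ofReal (S.side ^ (-p))) := by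
          rw [setLIntegral_const]
      _ ≤ ENNReal.ofReal (4 * W) * (∫⁻ x in E S, ENNReal.ofReal (c ^ p) * w x) := by
          gcongr 1
          apply setLIntegral_mono' (hEm S hS)
          intro x hx
          rw [hw, ← ENNReal.ofReal_mul (by positivity)]
          exact ENNReal.ofReal_le_ofReal (hb2 x (hES S hS hx))
      _ = _ := by
          rw [lintegral_const_mul _ (by fun_prop), withDensity_apply _ (hEm S hS), ← mul_assoc,
            ← ENNReal.ofReal_mul (by positivity)]
          congr 2; ring
  calc sparseFormM 𝒮 F r s (U.indicator 1) (V.indicator 1)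
      ≤ ∑' S : 𝒮, ENNReal.ofReal (4 * c ^ p * W) * (volume.withDensity w) (E S) :=
        ENNReal.tsum_le_tsum key
    _ = ENNReal.ofReal (4 * c ^ p * W) * ∑' S : 𝒮, (volume.withDensity w) (E S) := ENNReal.tsum_mul_left
    _ ≤ ENNReal.ofReal (4 * c ^ p * W) * I := by
        gcongr
        refine (tsum_meas_le_meas_iUnion_of_disjoint _ (fun S : 𝒮 => hEm S S.2) ?_).trans ?_
        · intro S T hST
          exact hEd S.2 T.2 (fun h => hST (Subtype.ext h))
        · refine (measure_mono (subset_univ _)).trans ?_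
          rw [withDensity_apply _ MeasurableSet.univ, Measure.restrict_univ]
    _ = _ := by
        rw [← ENNReal.ofReal_toReal hfin.ne, ← ENNReal.ofReal_mul (by positivity)]
        congr 1
        rw [ENNReal.toReal_ofReal ENNReal.toReal_nonneg]
        ring

theorem avg_bd (n : ℕ) (hn : 2 ≤ n) (U : Set (Rn n)) (t : ℝ) (x : Rn n) :
    0 ≤ sphereAvg n t (U.indicator 1) x ∧ sphereAvg n t (U.indicator 1) x ≤ 1 := by
  have := sphMeasure_prob n hn
  constructor
  · exact integral_nonneg fun y => indicator_nonneg (fun _ _ => zero_le_one) _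
  · refine (le_abs_self _).trans ?_
    have h := norm_integral_le_of_norm_le_const (μ := sphMeasure n) (C := 1)
      (f := fun y => U.indicator (1 : Rn n → ℝ) (x - t • y)) (Eventually.of_forall fun y => by
        refine (norm_indicator_le_norm_self _ _).trans ?_
        simp)
    rw [probReal_univ, mul_one] at h
    exact h

theorem avg_meas (n : ℕ) (hn : 2 ≤ n) (U : Set (Rn n)) (hU : MeasurableSet U) (t : ℝ) :
    Measurable (sphereAvg n t (U.indicator 1)) := by
  have := sphMeasure_prob n hn
  unfold sphereAvg
  refine StronglyMeasurable.measurable ?_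
  refine StronglyMeasurable.integral_prod_right (f := fun x y => U.indicator (1 : Rn n → ℝ) (x - t • y)) ?_
  apply Measurable.stronglyMeasurable
  exact (measurable_one.indicator hU).comp (by fun_prop)

theorem Mlac_eq (n : ℕ) (U : Set (Rn n)) (x : Rn n) :
    Mlac n (U.indicator 1) x = ⨆ j : ℤ, sphereAvg n ((2:ℝ)^j) (U.indicator 1) x := by
  unfold Mlac
  have : (fun z => |U.indicator (1 : Rn n → ℝ) z|) = U.indicator 1 := by
    ext z
    exact abs_of_nonneg (indicator_nonneg (fun _ _ => zero_le_one) _)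
  rw [this]

theorem Mlac_int (n : ℕ) (hn : 2 ≤ n) (U V : Set (Rn n)) (hU : MeasurableSet U) (hV : MeasurableSet V)
    (hV' : volume V ≠ ∞) :
    ∫ x, sphereAvg n 1 (U.indicator 1) x * V.indicator 1 x ≤
      ∫ x, Mlac n (U.indicator 1) x * V.indicator 1 x := by
  have hint : Integrable (V.indicator (1 : Rn n → ℝ)) := 
    (integrable_indicator_iff hV).2 (integrableOn_const hV')
  have hvn : ∀ x, 0 ≤ V.indicator (1 : Rn n → ℝ) x := indicator_nonneg (fun _ _ => zero_le_one)
  have hbdd : ∀ x, BddAbove (range fun j : ℤ => sphereAvg n ((2:ℝ)^j) (U.indicator 1) x) := by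
    intro x
    refine ⟨1, ?_⟩
    rintro _ ⟨j, rfl⟩
    exact (avg_bd n hn U _ x).2
  have hle : ∀ x, sphereAvg n 1 (U.indicator 1) x ≤ Mlac n (U.indicator 1) x := by
    intro x
    rw [Mlac_eq]
    have := le_ciSup (hbdd x) 0
    simpa using this
  have hm : Measurable (Mlac n (U.indicator 1)) := by
    rw [show Mlac n (U.indicator 1) = _ from funext (Mlac_eq n U)]
    exact Measurable.iSup fun j => avg_meas n hn U hU _
  apply integral_mono_of_nonneg
  · exact Eventually.of_forall fun x => mul_nonneg (avg_bd n hn U _ x).1 (hvn x)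
  · refine hint.mono' (hm.mul (measurable_one.indicator hV)).aestronglyMeasurable ?_
    refine Eventually.of_forall fun x => ?_
    have h0 : 0 ≤ Mlac n (U.indicator 1) x := (avg_bd n hn U _ x).1.trans (hle x)
    have h1 : Mlac n (U.indicator 1) x ≤ 1 := by
      rw [Mlac_eq]
      exact ciSup_le fun j => (avg_bd n hn U _ x).2
    rw [Real.norm_eq_abs, abs_of_nonneg (mul_nonneg h0 (hvn x))]
    exact mul_le_of_le_one_left (hvn x) h1
  · exact Eventually.of_forall fun x => mul_le_mul_of_nonneg_right (hle x) (hvn x)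

def annulus (n : ℕ) (δ : ℝ) : Set (Rn n) := {x | 1 - δ < ‖x‖ ∧ ‖x‖ < 1 + δ}

theorem annulus_meas (n : ℕ) (δ : ℝ) : MeasurableSet (annulus n δ) := by
  apply IsOpen.measurableSet
  exact (isOpen_lt continuous_const continuous_norm).inter (isOpen_lt continuous_norm continuous_const)

theorem annulus_mem {n : ℕ} {δ : ℝ} {x y : Rn n} (hx : ‖x‖ < δ) (hy : ‖y‖ = 1) : x - y ∈ annulus n δ := by
  have h1 := abs_norm_sub_norm_le y x
  have h2 := norm_sub_le x y
  rw [norm_sub_rev] at h1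
  rw [abs_le] at h1
  constructor <;> linarith

theorem case_a (n : ℕ) (hn : 2 ≤ n) (δ : ℝ) :
    volume.real (ball (0 : Rn n) δ) ≤
      ∫ x, Mlac n ((annulus n δ).indicator 1) x * (ball (0 : Rn n) δ).indicator 1 x := by
  have := sphMeasure_prob n hn
  refine le_trans (le_of_eq ?_) (Mlac_int n hn _ _ (annulus_meas n δ) measurableSet_ball measure_ball_lt_top.ne)
  rw [← integral_indicator_one measurableSet_ball]
  congr 1
  ext x
  by_cases hx : x ∈ ball (0 : Rn n) δ
  · rw [indicator_of_mem hx]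
    have : sphereAvg n 1 ((annulus n δ).indicator 1) x = ∫ y, (1:ℝ) ∂(sphMeasure n) := by
      unfold sphereAvg
      apply integral_congr_ae
      filter_upwards [sphMeasure_ae n] with y hy
      rw [one_smul, indicator_of_mem (annulus_mem (by simpa using hx) hy)]; rfl
    rw [this]; simp
  · simp [indicator_of_notMem hx]

theorem case_b (n : ℕ) (hn : 2 ≤ n) (δ : ℝ) :
    volume.real (ball (0 : Rn n) δ) ≤
      ∫ x, Mlac n ((ball (0 : Rn n) δ).indicator 1) x * (annulus n δ).indicator 1 x := by
  have := sphMeasure_prob n hn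
  have hfin : volume (annulus n δ) ≠ ∞ := by
    refine ((measure_mono ?_).trans_lt (measure_ball_lt_top (x := (0 : Rn n)) (r := 1 + δ))).ne
    intro x hx; simpa using hx.2
  refine le_trans (le_of_eq ?_) (Mlac_int n hn _ _ measurableSet_ball (annulus_meas n δ) hfin)
  set B := ball (0 : Rn n) δ with hB
  have hBm : MeasurableSet B := measurableSet_ball
  have h1 : ∀ x, sphereAvg n 1 (B.indicator 1) x * (annulus n δ).indicator 1 x = 
      sphereAvg n 1 (B.indicator 1) x := by
    intro x
    by_cases hx : x ∈ annulus n δ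
    · simp [indicator_of_mem hx]
    · rw [indicator_of_notMem hx, mul_zero]
      symm
      apply integral_eq_zero_of_ae
      filter_upwards [sphMeasure_ae n] with y hy
      apply indicator_of_notMem
      intro h
      apply hx
      have := annulus_mem (x := x - (1:ℝ) • y) (y := -y) (δ := δ) (by simpa [hB] using h) (by simpa using hy)
      simpa using this
  simp_rw [h1]
  rw [← ENNReal.toReal_ofReal (integral_nonneg fun x => (avg_bd n hn B 1 x).1)] 
  unfold Measure.real
  congr 1
  rw [integral_eq_lintegral_of_nonneg_ae (Eventually.of_forall fun x => (avg_bd n hn B 1 x).1)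
    (avg_meas n hn B hBm 1).aestronglyMeasurable]
  have h2 : ∫⁻ x, ENNReal.ofReal (sphereAvg n 1 (B.indicator 1) x) = volume B := by
    have h3 : ∀ x, ENNReal.ofReal (sphereAvg n 1 (B.indicator 1) x) =
        ∫⁻ y, B.indicator (1 : Rn n → ℝ≥0∞) (x - y) ∂(sphMeasure n) := by
      intro x
      have hmm : Measurable fun y => B.indicator (1 : Rn n → ℝ) (x - (1:ℝ) • y) := 
        (measurable_one.indicator hBm).comp (by fun_prop)
      have hnn : ∀ y, 0 ≤ B.indicator (1 : Rn n → ℝ) (x - (1:ℝ) • y) := 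
        fun y => indicator_nonneg (fun _ _ => zero_le_one) _
      unfold sphereAvg
      rw [ofReal_integral_eq_lintegral_ofReal _ (Eventually.of_forall hnn)]
      · congr 1
        ext y
        rw [one_smul]
        by_cases h : x - y ∈ B <;> simp [h]
      · refine (integrable_const (1:ℝ)).mono' hmm.aestronglyMeasurable (Eventually.of_forall fun y => ?_)
        refine (norm_indicator_le_norm_self _ _).trans ?_
        simp
    simp_rw [h3]
    rw [lintegral_lintegral_swap]
    · have h4 : ∀ y : Rn n, ∫⁻ x, B.indicator (1 : Rn n → ℝ≥0∞) (x - y) = volume B := by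
        intro y
        rw [lintegral_sub_right_eq_self (fun x => B.indicator (1 : Rn n → ℝ≥0∞) x) y,
          lintegral_indicator_one hBm]
      simp_rw [h4]
      simp
    · exact ((measurable_one.indicator hBm).comp (measurable_fst.sub measurable_snd)).aemeasurable
  rw [h2, ENNReal.ofReal_toReal measure_ball_lt_top.ne]

theorem annulus_vol (n : ℕ) (hn : 2 ≤ n) : ∃ c : ℝ, 0 ≤ c ∧ ∀ δ, 0 < δ → δ ≤ 1/4 →
    volume.real (annulus n δ) ≤ c * δ := by
  set b := volume.real (ball (0 : Rn n) 1) with hb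
  have : Nontrivial (Rn n) := by
    have : Nonempty (Fin n) := ⟨⟨0, by omega⟩⟩
    infer_instance
  refine ⟨n * 2 ^ (n-1) * 2 * b, by positivity, ?_⟩
  intro δ h0 h1
  have hball : ∀ t, 0 ≤ t → volume.real (ball (0 : Rn n) t) = t ^ n * b := by
    intro t ht
    rw [hb, Measure.real, Measure.addHaar_ball _ _ ht, finrank_euclideanSpace_fin, ENNReal.toReal_mul,
      ENNReal.toReal_ofReal (by positivity)]
    rfl
  have hsub : annulus n δ ⊆ ball (0 : Rn n) (1 + δ) \ ball 0 (1 - δ) := by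
    intro x hx
    refine ⟨by simpa using hx.2, ?_⟩
    simpa using hx.1.le
  calc volume.real (annulus n δ) ≤ volume.real (ball (0 : Rn n) (1 + δ) \ ball 0 (1 - δ)) :=
        measureReal_mono hsub (((measure_mono sdiff_subset).trans_lt measure_ball_lt_top).ne)
    _ = (1 + δ)^n * b - (1 - δ)^n * b := by
        rw [measureReal_sdiff (ball_subset_ball (by linarith)) measurableSet_ball,
          hball _ (by linarith), hball _ (by linarith)]
    _ = ((1 + δ)^n - (1 - δ)^n) * b := by ring
    _ ≤ (n * 2 ^ (n-1) * (2 * δ)) * b := by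
        gcongr
        have h := abs_pow_sub_pow_le (1 + δ) (1 - δ) n
        have h2 : max |1 + δ| |1 - δ| ≤ 2 := by
          apply max_le <;> rw [abs_le] <;> constructor <;> linarith
        rw [show (1 + δ) - (1 - δ) = 2 * δ by ring, abs_of_pos (show 0 < 2 * δ by linarith)] at h
        refine (le_abs_self _).trans (h.trans ?_)
        calc 2 * δ * n * max |1 + δ| |1 - δ| ^ (n-1) ≤ 2 * δ * n * 2 ^ (n-1) := by gcongr
          _ = _ := by ring
    _ = _ := by ring

theorem small (D b : ℝ) (hb : 0 < b) (p q : ℝ) (hpq : q < p) :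
    ∃ δ : ℝ, 0 < δ ∧ δ ≤ 1/4 ∧ D * δ ^ p < b * δ ^ q := by
  have h : Tendsto (fun δ : ℝ => D * δ ^ (p - q)) (𝓝[>] 0) (𝓝 0) := by
    have h1 : Tendsto (fun δ : ℝ => δ ^ (p - q)) (𝓝[>] 0) (𝓝 0) := by
      have := (Real.continuousAt_rpow_const (0:ℝ) (p - q) (Or.inr (by linarith))).tendsto
      rw [Real.zero_rpow (by linarith)] at this
      exact this.mono_left nhdsWithin_le_nhds
    simpa using h1.const_mul D
  have h2 := h.eventually (gt_mem_nhds hb)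
  have h3 : ∀ᶠ δ : ℝ in 𝓝[>] 0, δ < 1/4 := nhdsWithin_le_nhds (gt_mem_nhds (by norm_num))
  obtain ⟨δ, h2, h3, h4⟩ := (h2.and (h3.and self_mem_nhdsWithin)).exists
  have h4 : 0 < δ := h4
  refine ⟨δ, h4, h3.le, ?_⟩
  have : δ ^ p = δ ^ (p - q) * δ ^ q := by rw [← Real.rpow_add h4]; simp
  rw [this, ← mul_assoc]
  gcongr

theorem region (n : ℕ) (hn : 2 ≤ n) (a b : ℝ) (hab : 1 < a + b) (h : (a, b) ∉ Lregion n) :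
    n < n * a + b ∨ n < a + n * b := by
  by_contra! hc
  apply h
  have hn' : (2:ℝ) ≤ n := by exact_mod_cast hn
  have hn1 : (0:ℝ) < n - 1 := by linarith
  have hconv := convex_convexHull ℝ {((0 : ℝ), (1 : ℝ)), (1, 0), ((n : ℝ)/(n+1), (n : ℝ)/(n+1))}
  have hmem := hconv.sum_mem (t := Finset.univ)
    (w := ![(n - b - n * a) / (n - 1), (n - a - n * b) / (n - 1), (a + b - 1) * (n + 1) / (n - 1)])
    (z := ![((0 : ℝ), (1 : ℝ)), (1, 0), ((n : ℝ)/(n+1), (n : ℝ)/(n+1))]) ?_ ?_ ?_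
  · unfold Lregion
    convert hmem using 1
    simp only [Fin.sum_univ_three, Matrix.cons_val_zero, Matrix.cons_val_one, Matrix.cons_val,
      Prod.smul_mk, Prod.mk_add_mk, smul_eq_mul]
    rw [Prod.mk.injEq]
    constructor <;> field_simp <;> ring
  · intro i _
    fin_cases i
    · exact div_nonneg (by linarith [hc.1]) hn1.le
    · exact div_nonneg (by linarith [hc.2]) hn1.le
    · exact div_nonneg (mul_nonneg (by linarith) (by linarith)) hn1.le
  · simp only [Fin.sum_univ_three, Matrix.cons_val_zero, Matrix.cons_val_one, Matrix.cons_val]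
    field_simp
    ring
  · intro i _
    apply subset_convexHull
    fin_cases i <;> simp

theorem ball_vol (n : ℕ) (hn : 2 ≤ n) {δ : ℝ} (h : 0 < δ) :
    volume.real (ball (0 : Rn n) δ) = volume.real (ball (0 : Rn n) 1) * δ ^ (n : ℝ) := by
  rw [Measure.real, Measure.addHaar_ball_of_pos _ _ h, finrank_euclideanSpace_fin, ENNReal.toReal_mul,
      ENNReal.toReal_ofReal (by positivity), Real.rpow_natCast, mul_comm]
  rfl

theorem sep {n : ℕ} {δ : ℝ} (h : δ ≤ 1/4) {u v : Rn n} (hu : u ∈ ball (0 : Rn n) δ)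
    (hv : v ∈ annulus n δ) : 1/2 ≤ dist u v := by
  have hu : ‖u‖ < δ := by simpa using hu
  have := norm_sub_norm_le v u
  rw [dist_comm, dist_eq_norm]
  linarith [hv.1]

theorem ann_sub {n : ℕ} {δ : ℝ} (h : δ ≤ 1/4) : annulus n δ ⊆ closedBall 0 2 := by
  intro x hx
  simp only [mem_closedBall, dist_zero_right]
  linarith [hx.2]

theorem ballsub_two {n : ℕ} {δ : ℝ} (h : δ ≤ 1/4) : ball (0 : Rn n) δ ⊆ closedBall 0 2 :=
  ball_subset_closedBall.trans (closedBall_subset_closedBall (by linarith))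

theorem ind_cpt {n : ℕ} {U : Set (Rn n)} (h : U ⊆ closedBall 0 2) :
    HasCompactSupport (U.indicator (1 : Rn n → ℝ)) :=
  HasCompactSupport.intro (isCompact_closedBall (0 : Rn n) 2) fun _ hx =>
    indicator_of_notMem (fun h' => hx (h h')) _

theorem finish (n : ℕ) (r s C : ℝ) (U V : Set (Rn n)) (hU : MeasurableSet U)
    (hV : MeasurableSet V) (hU2 : U ⊆ closedBall 0 2) (hV2 : V ⊆ closedBall 0 2) (K W b : ℝ)
    (hK : supSparseFormM n r s (U.indicator 1) (V.indicator 1) ≤ ENNReal.ofReal (K * W))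
    (hb : 0 < b)
    (h1 : max C 0 * (K * W) < b) (h2 : b ≤ ∫ x, Mlac n (U.indicator 1) x * V.indicator 1 x) :
    ∃ f g : Rn n → ℝ, Measurable f ∧ Measurable g ∧
      (∀ x, 0 ≤ f x) ∧ (∀ x, 0 ≤ g x) ∧
      (∃ M, ∀ x, f x ≤ M) ∧ (∃ M, ∀ x, g x ≤ M) ∧
      HasCompactSupport f ∧ HasCompactSupport g ∧
      ENNReal.ofReal C * supSparseFormM n r s f g
        < ENNReal.ofReal (∫ x, Mlac n f x * g x) := by
  refine ⟨U.indicator 1, V.indicator 1, measurable_one.indicator hU, measurable_one.indicator hV,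
    indicator_nonneg (fun _ _ => zero_le_one), indicator_nonneg (fun _ _ => zero_le_one),
    ⟨1, fun x => indicator_le_self' (fun _ _ => zero_le_one) x⟩,
    ⟨1, fun x => indicator_le_self' (fun _ _ => zero_le_one) x⟩, ind_cpt hU2, ind_cpt hV2, ?_⟩
  calc _ ≤ ENNReal.ofReal (max C 0) * ENNReal.ofReal (K * W) := by
        gcongr
        exact le_max_left _ _
    _ = ENNReal.ofReal (max C 0 * (K * W)) := by rw [ENNReal.ofReal_mul (le_max_right _ _)]
    _ < ENNReal.ofReal b := (ENNReal.ofReal_lt_ofReal_iff hb).2 h1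
    _ ≤ _ := ENNReal.ofReal_le_ofReal h2

end Aux

/-- If `1/r + 1/s > 1` and `(1/r, 1/s)` is not in the closed triangle `L_n`,
then the sparse bound `‖M_lac : (r,s)_m‖ < ∞` fails. -/
theorem lacunary_sparse_bound_fails (n : ℕ) (hn : 2 ≤ n) (r s : ℝ) (hr : 1 ≤ r) (hs : 1 ≤ s)
    (hrs : 1 < 1/r + 1/s) (hmem : ((1/r, 1/s) : ℝ × ℝ) ∉ Lregion n) :
    ∀ C : ℝ, ∃ f g : Rn n → ℝ, Measurable f ∧ Measurable g ∧
      (∀ x, 0 ≤ f x) ∧ (∀ x, 0 ≤ g x) ∧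
      (∃ M, ∀ x, f x ≤ M) ∧ (∃ M, ∀ x, g x ≤ M) ∧
      HasCompactSupport f ∧ HasCompactSupport g ∧
      ENNReal.ofReal C * supSparseFormM n r s f g
        < ENNReal.ofReal (∫ x, Mlac n f x * g x) := by
  intro C
  obtain ⟨K, hK0, hK⟩ := sparse_le n hn r s hr hs hrs
  obtain ⟨c, hc0, hc⟩ := annulus_vol n hn
  have hβ : 0 < volume.real (ball (0 : Rn n) 1) :=
    ENNReal.toReal_pos (measure_ball_pos volume (0 : Rn n) one_pos).ne' measure_ball_lt_top.ne
  have hC0 : 0 ≤ max C 0 := le_max_right _ _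
  rcases region n hn _ _ hrs hmem with h | h
  · obtain ⟨δ, h0, h4, hδ⟩ := small
      (max C 0 * (K * (volume.real (ball (0 : Rn n) 1) ^ (1/r) * c ^ (1/s)))) _ hβ _ _ h
    refine finish n r s C (ball 0 δ) (annulus n δ) measurableSet_ball (annulus_meas n δ) (ballsub_two h4)
      (ann_sub h4) K _ (volume.real (ball (0 : Rn n) δ)) 
      (hK _ _ measurableSet_ball (annulus_meas n δ) (ballsub_two h4) (ann_sub h4) (fun u hu v hv => sep h4 hu hv))
      ?_ ?_ (case_b n hn δ)
    · rw [ball_vol n hn h0]; positivity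
    · rw [ball_vol n hn h0]
      refine lt_of_le_of_lt ?_ hδ
      have e : δ ^ (n * (1/r) + 1/s) = (δ ^ (n:ℝ)) ^ (1/r) * δ ^ (1/s) := by
        rw [Real.rpow_add h0, Real.rpow_mul h0.le]
      calc _ ≤ max C 0 * (K * ((volume.real (ball (0 : Rn n) 1) * δ ^ (n:ℝ)) ^ (1/r) * (c * δ) ^ (1/s))) := by
            gcongr
            exact hc δ h0 h4
        _ = _ := by
            rw [e, Real.mul_rpow hβ.le (by positivity), Real.mul_rpow hc0 h0.le]
            ring
  · obtain ⟨δ, h0, h4, hδ⟩ := small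
      (max C 0 * (K * (c ^ (1/r) * volume.real (ball (0 : Rn n) 1) ^ (1/s)))) _ hβ _ _ h
    refine finish n r s C (annulus n δ) (ball 0 δ) (annulus_meas n δ) measurableSet_ball (ann_sub h4)
      (ballsub_two h4) K _ (volume.real (ball (0 : Rn n) δ)) 
      (hK _ _ (annulus_meas n δ) measurableSet_ball (ann_sub h4) (ballsub_two h4)
        (fun u hu v hv => by rw [dist_comm]; exact sep h4 hv hu))
      ?_ ?_ (case_a n hn δ)
    · rw [ball_vol n hn h0]; positivity
    · rw [ball_vol n hn h0]
      refine lt_of_le_of_lt ?_ hδ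
      have e : δ ^ (1/r + n * (1/s)) = δ ^ (1/r) * (δ ^ (n:ℝ)) ^ (1/s) := by
        rw [Real.rpow_add h0, Real.rpow_mul h0.le]
      calc _ ≤ max C 0 * (K * ((c * δ) ^ (1/r) * (volume.real (ball (0 : Rn n) 1) * δ ^ (n:ℝ)) ^ (1/s))) := by
            gcongr
            exact hc δ h0 h4
        _ = _ := by
            rw [e, Real.mul_rpow hβ.le (by positivity), Real.mul_rpow hc0 h0.le]
            ring
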